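/- arXiv:2501.10818 — 6 statements merged into one kernel-verified Lean document; each statement's English description precedes it below -/
import Mathlib

section
/- Let ν>0 and define the multipliers 𝓜₁(k,ξ) = arctan(ν^{1/3}|k|^{-1/3} sgn(k) ξ) + π/2 and 𝓜₂(k,ξ) = arctan(ξ/k) + π/2 for k≠0. Then for every smooth, rapidly decaying function f on ℝ² one has (i) ∫_{ℝ²} k ∂_ξ𝓜₁(k,ξ) |f̂(k,ξ)|² dk dξ ≥ (ν^{1/3}/4) ∫_{ℝ²} |k|^{2/3} |f̂(k,ξ)|² dk dξ − (ν/2) ∫_{ℝ²} ξ² |f̂(k,ξ)|² dk dξ, where k∂_ξ𝓜₁(k,ξ) = ν^{1/3}|k|^{2/3}/(1+ν^{2/3}|k|^{-2/3}ξ²); and (ii) ∫_{ℝ²} k ∂_ξ𝓜₂(k,ξ) |f̂(k,ξ)|² dk dξ = ∫_{ℝ²} (k²/(k²+ξ²)) |f̂(k,ξ)|² dk dξ ≥ ‖∂_x ∇ Δ^{-1} f‖²_{L²(ℝ²)}. -/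
open MeasureTheory Real

noncomputable section

/-- Japanese bracket `⟨a⟩ = (1+a²)^{1/2}`. -/
def jap (a : ℝ) : ℝ := Real.sqrt (1 + a ^ 2)

/-- `⟨a,b⟩ = (1+a²+b²)^{1/2}`. -/
def jap2 (a b : ℝ) : ℝ := Real.sqrt (1 + a ^ 2 + b ^ 2)

/-- `⟨1/a⟩ = (1+a⁻²)^{1/2}`. -/
def japInv (a : ℝ) : ℝ := Real.sqrt (1 + (a⁻¹) ^ 2)

/-- `λ(k) = min(1, |k|^{2/3})`. -/
def lamED (k : ℝ) : ℝ := min 1 (|k| ^ ((2:ℝ)/3))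

/-- Fourier transform on `ℝ²`. -/
def FT2 (f : ℝ × ℝ → ℂ) (p : ℝ × ℝ) : ℂ :=
  ∫ q : ℝ × ℝ, Complex.exp (-(((2 * π * (p.1 * q.1 + p.2 * q.2) : ℝ) : ℂ) * Complex.I)) * f q

/-- Inverse Fourier transform on `ℝ²`. -/
def invFT2 (g : ℝ × ℝ → ℂ) (q : ℝ × ℝ) : ℂ :=
  ∫ p : ℝ × ℝ, Complex.exp (((2 * π * (p.1 * q.1 + p.2 * q.2) : ℝ) : ℂ) * Complex.I) * g p

/-- `L²(ℝ²)` norm. -/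
def L2N (g : ℝ × ℝ → ℂ) : ℝ := Real.sqrt (∫ p : ℝ × ℝ, ‖g p‖ ^ 2)

/-- `L¹(ℝ²)` norm. -/
def L1N (g : ℝ × ℝ → ℂ) : ℝ := ∫ p : ℝ × ℝ, ‖g p‖

/-- `L^p(ℝ²)` norm, `p` a real exponent. -/
def LpN (p : ℝ) (g : ℝ × ℝ → ℂ) : ℝ := (∫ q : ℝ × ℝ, ‖g q‖ ^ p) ^ p⁻¹

/-- Symbol of the Fourier-side transport nonlinearity of the 2D Navier–Stokes equations. -/
def nlSym (k l ξ η : ℝ) : ℝ := (η * (k - l) - l * (ξ - η)) / (l ^ 2 + η ^ 2)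

/-- Fourier transform of `-(u·∇ω)` where `u = ∇^⊥(-Δ)⁻¹ω` (Biot–Savart law). -/
def NLF (w : ℝ × ℝ → ℂ) (p : ℝ × ℝ) : ℂ :=
  ∫ q : ℝ × ℝ, ((nlSym p.1 q.1 p.2 q.2 : ℝ) : ℂ) * w q * w (p.1 - q.1, p.2 - q.2)

/-- Fourier-side formulation of the 2D Navier–Stokes vorticity equation near the Couette flow:
`∂ₜŵ - k ∂_ξ ŵ + ν(k²+ξ²) ŵ = (-(u·∇ω))^`, with initial data `win` (Fourier side). -/
def IsNSCouetteF (ν : ℝ) (win : ℝ × ℝ → ℂ) (w : ℝ → ℝ × ℝ → ℂ) : Prop :=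
  (∀ p : ℝ × ℝ, w 0 p = win p) ∧
  ∀ t : ℝ, 0 < t → ∀ k ξ : ℝ,
    HasDerivAt (fun s => w s (k, ξ))
      ((k : ℂ) * deriv (fun ξ' => w t (k, ξ')) ξ
        - ((ν * (k ^ 2 + ξ ^ 2) : ℝ) : ℂ) * w t (k, ξ)
        + NLF (w t) (k, ξ)) t

/-- Kelvin's explicit solution of the linearized equation, on the Fourier side. -/
def kelvin (ν : ℝ) (win : ℝ × ℝ → ℂ) (t : ℝ) (p : ℝ × ℝ) : ℂ :=
  win (p.1, p.2 + p.1 * t) *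
    ((Real.exp (-(ν * ∫ s in (0:ℝ)..t, (p.1 ^ 2 + (p.2 + p.1 * (t - s)) ^ 2))) : ℝ) : ℂ)

/-- Enhanced dissipation multiplier `𝓜₁`. -/
def M1 (ν k ξ : ℝ) : ℝ :=
  Real.arctan (ν ^ ((1:ℝ)/3) * |k| ^ (-(1:ℝ)/3) * Real.sign k * ξ) + π / 2

/-- Inviscid damping multiplier `𝓜₂`. -/
def M2 (k ξ : ℝ) : ℝ := Real.arctan (ξ / k) + π / 2

/-- Echo multiplier `𝓜₃`. -/
def M3 (κ t k ξ : ℝ) : ℝ :=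
  ∫ l : ℝ, japInv l ^ (-(1 + κ)) * (|l| ^ 2)⁻¹ *
    (Real.sign l * Real.arctan ((ξ + t * (k - l)) / (1 + |k - l| + |l|)) + π / 2)

/-- Dissipation symbol `Υ = (-∂ₜ + k∂_ξ)𝓜₃` of the echo multiplier `𝓜₃`. -/
def Upsilon (κ t k ξ : ℝ) : ℝ :=
  ∫ l : ℝ, japInv l ^ (-(1 + κ)) * |l|⁻¹ *
    ((1 + |k - l| + |l|) / ((1 + |k - l| + |l|) ^ 2 + (ξ + t * (k - l)) ^ 2))

/-- Weight `e^{cν^{1/3}λ(k)t}⟨k⟩⟨1/k⟩^ε`. -/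
def edWlam (c ν ε t : ℝ) (p : ℝ × ℝ) : ℝ :=
  Real.exp (c * ν ^ ((1:ℝ)/3) * lamED p.1 * t) * jap p.1 * japInv p.1 ^ ε

/-- Weight `e^{cν^{1/3}|k|^{2/3}t}⟨k⟩^m⟨1/k⟩^ε`. -/
def edW23 (c ν m ε t : ℝ) (p : ℝ × ℝ) : ℝ :=
  Real.exp (c * ν ^ ((1:ℝ)/3) * |p.1| ^ ((2:ℝ)/3) * t) * jap p.1 ^ m * japInv p.1 ^ ε

end
/-- The Fourier transform of a Schwartz function on `ℝ × ℝ` is a Schwartz function. -/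
theorem exists_schwartzMap_eq_FT2 (f : SchwartzMap (ℝ × ℝ) ℂ) :
    ∃ g : SchwartzMap (ℝ × ℝ) ℂ, FT2 f = g := by
  let e := WithLp.prodContinuousLinearEquiv 2 ℝ ℝ ℝ
  refine ⟨SchwartzMap.compCLMOfContinuousLinearEquiv ℂ e.symm
    (FourierTransform.fourier (SchwartzMap.compCLMOfContinuousLinearEquiv ℂ e f)), ?_⟩
  ext p
  simp only [SchwartzMap.compCLMOfContinuousLinearEquiv_apply, Function.comp_apply,
    SchwartzMap.fourier_coe, Real.fourier_eq']
  rw [FT2, ← (WithLp.volume_preserving_ofLp ℝ ℝ).integral_comp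
    e.toHomeomorph.measurableEmbedding]
  refine integral_congr_ae (.of_forall fun q => ?_)
  simp [e, smul_eq_mul, WithLp.prod_inner_apply]

theorem integrable_pow_norm_mul_sq_norm (g : SchwartzMap (ℝ × ℝ) ℂ) (n : ℕ) :
    Integrable fun p : ℝ × ℝ => ‖p‖ ^ n * ‖g p‖ ^ 2 := by
  obtain ⟨C, hC⟩ := g.decay 0 0
  have h := (g.integrable_pow_mul volume n).mul_const C
  refine h.mono' (by fun_prop) (.of_forall fun p => ?_)
  have hp : ‖g p‖ ≤ C := by simpa using hC.2 p
  rw [Real.norm_of_nonneg (by positivity), mul_assoc, sq]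
  gcongr

theorem abs_rpow_le_one_add_sq (x : ℝ) : |x| ^ ((2 : ℝ) / 3) ≤ 1 + x ^ 2 := by
  rcases le_total |x| 1 with h | h
  · have := Real.rpow_le_one (abs_nonneg x) h (show (0 : ℝ) ≤ 2 / 3 by norm_num)
    nlinarith [sq_nonneg x]
  · have := Real.rpow_le_rpow_of_exponent_le h (show (2 : ℝ) / 3 ≤ (2 : ℕ) by norm_num)
    rw [Real.rpow_natCast, sq_abs] at this
    linarith

theorem mul_deriv_M1 {ν : ℝ} (hν : 0 < ν) (k ξ : ℝ) :
    k * deriv (fun ξ' => M1 ν k ξ') ξ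
      = ν ^ ((1:ℝ)/3) * |k| ^ ((2:ℝ)/3) / (1 + ν ^ ((2:ℝ)/3) * |k| ^ (-(2:ℝ)/3) * ξ ^ 2) := by
  rcases eq_or_ne k 0 with rfl | hk
  · simp [Real.zero_rpow]
  have hk' : 0 < |k| := abs_pos.mpr hk
  set c := ν ^ ((1:ℝ)/3) * |k| ^ (-(1:ℝ)/3) * Real.sign k with hc
  have hd : HasDerivAt (fun ξ' => M1 ν k ξ') (1 / (1 + (c * ξ) ^ 2) * (c * 1)) ξ :=
    (((hasDerivAt_id ξ).const_mul c).arctan).add_const _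
  have hs : Real.sign k * k = |k| := by
    rcases hk.lt_or_gt with h | h
    · simp [Real.sign_of_neg h, abs_of_neg h]
    · simp [Real.sign_of_pos h, abs_of_pos h]
  have hs2 : Real.sign k ^ 2 = 1 := by
    rcases hk.lt_or_gt with h | h
    · simp [Real.sign_of_neg h]
    · simp [Real.sign_of_pos h]
  have hν2 : (ν ^ ((1:ℝ)/3)) ^ 2 = ν ^ ((2:ℝ)/3) := by
    rw [← Real.rpow_mul_natCast hν.le]; norm_num
  have hk2 : (|k| ^ (-(1:ℝ)/3)) ^ 2 = |k| ^ (-(2:ℝ)/3) := by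
    rw [← Real.rpow_mul_natCast hk'.le]; norm_num
  have hk3 : |k| ^ (-(1:ℝ)/3) * |k| = |k| ^ ((2:ℝ)/3) := by
    rw [← Real.rpow_add_one hk'.ne']; norm_num
  have hnum : k * c = ν ^ ((1:ℝ)/3) * |k| ^ ((2:ℝ)/3) := by
    rw [← hk3, hc]
    linear_combination ν ^ ((1:ℝ)/3) * |k| ^ (-(1:ℝ)/3) * hs
  have hden : (c * ξ) ^ 2 = ν ^ ((2:ℝ)/3) * |k| ^ (-(2:ℝ)/3) * ξ ^ 2 := by
    rw [hc, ← hν2, ← hk2]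
    linear_combination (ν ^ ((1:ℝ)/3)) ^ 2 * (|k| ^ (-(1:ℝ)/3)) ^ 2 * ξ ^ 2 * hs2
  rw [hd.deriv, ← hnum, ← hden]
  ring

theorem mul_deriv_M2 (k ξ : ℝ) :
    k * deriv (fun ξ' => M2 k ξ') ξ = k ^ 2 / (k ^ 2 + ξ ^ 2) := by
  rcases eq_or_ne k 0 with rfl | hk
  · simp
  have hd : HasDerivAt (fun ξ' => M2 k ξ') (1 / (1 + (ξ / k) ^ 2) * (1 / k)) ξ :=
    (((hasDerivAt_id ξ).div_const k).arctan).add_const _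
  have : k ^ 2 + ξ ^ 2 ≠ 0 := by positivity
  rw [hd.deriv]
  field_simp

/-- Pointwise enhanced-dissipation lower bound for `k ∂_ξ 𝓜₁`. -/
theorem le_mul_deriv_M1 {ν : ℝ} (hν : 0 < ν) (k ξ : ℝ) :
    ν ^ ((1:ℝ)/3) / 4 * |k| ^ ((2:ℝ)/3) - ν / 2 * ξ ^ 2
      ≤ k * deriv (fun ξ' => M1 ν k ξ') ξ := by
  rcases eq_or_ne k 0 with rfl | hk
  · have : 0 ≤ ν / 2 * ξ ^ 2 := by positivity
    simpa [Real.zero_rpow] using this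
  have hk' : 0 < |k| := abs_pos.mpr hk
  rw [mul_deriv_M1 hν]
  set a := ν ^ ((1:ℝ)/3) * |k| ^ ((2:ℝ)/3) with ha
  set b := ν ^ ((2:ℝ)/3) * |k| ^ (-(2:ℝ)/3) * ξ ^ 2 with hb
  have ha0 : 0 ≤ a := by positivity
  have hb0 : 0 ≤ b := by positivity
  have hνν : ν ^ ((1:ℝ)/3) * ν ^ ((2:ℝ)/3) = ν := by
    rw [← Real.rpow_add hν]; norm_num
  have hkk : |k| ^ ((2:ℝ)/3) * |k| ^ (-(2:ℝ)/3) = 1 := by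
    rw [← Real.rpow_add hk']; norm_num
  have hab : a * b = ν * ξ ^ 2 := by
    calc a * b = (ν ^ ((1:ℝ)/3) * ν ^ ((2:ℝ)/3))
            * (|k| ^ ((2:ℝ)/3) * |k| ^ (-(2:ℝ)/3)) * ξ ^ 2 := by
          rw [ha, hb]; ring
      _ = ν * ξ ^ 2 := by rw [hνν, hkk, mul_one]
  have key : 1 / 4 - b / 2 ≤ 1 / (1 + b) := by
    rw [le_div_iff₀ (by positivity)]
    nlinarith
  calc ν ^ ((1:ℝ)/3) / 4 * |k| ^ ((2:ℝ)/3) - ν / 2 * ξ ^ 2 = a * (1 / 4 - b / 2) := by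
        linear_combination (1 / 2) * hab - (1 / 4) * ha
    _ ≤ a * (1 / (1 + b)) := by gcongr
    _ = a / (1 + b) := by ring

/-- Properties of the multipliers `𝓜₁`, `𝓜₂`: explicit formulas for `k∂_ξ𝓜ᵢ` and the
resulting enhanced-dissipation and inviscid-damping lower bounds; by Plancherel,
`‖∂_x∇Δ⁻¹f‖²_{L²} = ∫ k²(k²+ξ²)/(k²+ξ²)² |f̂|²`. -/
theorem M1_M2_multiplier_estimates (ν : ℝ) (hν : 0 < ν) (f : SchwartzMap (ℝ × ℝ) ℂ) :
    (∀ k ξ : ℝ, k ≠ 0 →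
      k * deriv (fun ξ' => M1 ν k ξ') ξ
        = ν ^ ((1:ℝ)/3) * |k| ^ ((2:ℝ)/3) / (1 + ν ^ ((2:ℝ)/3) * |k| ^ (-(2:ℝ)/3) * ξ ^ 2)) ∧
    ((∫ p : ℝ × ℝ, p.1 * deriv (fun ξ' => M1 ν p.1 ξ') p.2 * ‖FT2 (⇑f) p‖ ^ 2)
      ≥ ν ^ ((1:ℝ)/3) / 4 * (∫ p : ℝ × ℝ, |p.1| ^ ((2:ℝ)/3) * ‖FT2 (⇑f) p‖ ^ 2)
        - ν / 2 * (∫ p : ℝ × ℝ, p.2 ^ 2 * ‖FT2 (⇑f) p‖ ^ 2)) ∧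
    (∀ k ξ : ℝ, k ≠ 0 →
      k * deriv (fun ξ' => M2 k ξ') ξ = k ^ 2 / (k ^ 2 + ξ ^ 2)) ∧
    ((∫ p : ℝ × ℝ, p.1 * deriv (fun ξ' => M2 p.1 ξ') p.2 * ‖FT2 (⇑f) p‖ ^ 2)
      = ∫ p : ℝ × ℝ, p.1 ^ 2 / (p.1 ^ 2 + p.2 ^ 2) * ‖FT2 (⇑f) p‖ ^ 2) ∧
    ((∫ p : ℝ × ℝ, p.1 ^ 2 / (p.1 ^ 2 + p.2 ^ 2) * ‖FT2 (⇑f) p‖ ^ 2)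
      ≥ ∫ p : ℝ × ℝ,
          p.1 ^ 2 * (p.1 ^ 2 + p.2 ^ 2) / (p.1 ^ 2 + p.2 ^ 2) ^ 2 * ‖FT2 (⇑f) p‖ ^ 2) := by
  obtain ⟨g, hg⟩ := exists_schwartzMap_eq_FT2 f
  rw [hg]
  have h0 : Integrable fun p : ℝ × ℝ => ‖g p‖ ^ 2 := by
    simpa using integrable_pow_norm_mul_sq_norm g 0
  have h2 := integrable_pow_norm_mul_sq_norm g 2
  have hξ : Integrable fun p : ℝ × ℝ => p.2 ^ 2 * ‖g p‖ ^ 2 := by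
    refine h2.mono' (by fun_prop) (.of_forall fun p => ?_)
    rw [Real.norm_of_nonneg (by positivity), ← sq_abs p.2]
    gcongr
    exact norm_snd_le p
  have hk : Integrable fun p : ℝ × ℝ => |p.1| ^ ((2:ℝ)/3) * ‖g p‖ ^ 2 := by
    refine (h0.add h2).mono' (Measurable.aestronglyMeasurable (by fun_prop)) (.of_forall fun p => ?_)
    rw [Real.norm_of_nonneg (by positivity), Pi.add_apply, ← one_add_mul]
    gcongr
    refine (abs_rpow_le_one_add_sq p.1).trans ?_
    rw [← sq_abs p.1]
    gcongr
    exact norm_fst_le p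
  have hM : Integrable fun p : ℝ × ℝ =>
      p.1 * deriv (fun ξ' => M1 ν p.1 ξ') p.2 * ‖g p‖ ^ 2 := by
    simp only [mul_deriv_M1 hν]
    refine (hk.const_mul (ν ^ ((1:ℝ)/3))).mono' (Measurable.aestronglyMeasurable (by fun_prop))
      (.of_forall fun p => ?_)
    rw [Real.norm_of_nonneg (by positivity), ← mul_assoc]
    gcongr
    refine div_le_self (by positivity) (le_add_of_nonneg_right (by positivity))
  refine ⟨fun k ξ _ => mul_deriv_M1 hν k ξ, ?_, fun k ξ _ => mul_deriv_M2 k ξ, ?_, ?_⟩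
  · rw [ge_iff_le, ← integral_const_mul, ← integral_const_mul,
      ← integral_sub (hk.const_mul _) (hξ.const_mul _)]
    refine integral_mono ((hk.const_mul _).sub (hξ.const_mul _)) hM fun p => ?_
    simp only [← mul_assoc, ← sub_mul]
    gcongr
    exact le_mul_deriv_M1 hν p.1 p.2
  · simp only [mul_deriv_M2]
  · refine (integral_congr_ae (.of_forall fun p => ?_)).le
    simp only [sq (p.1 ^ 2 + p.2 ^ 2)]
    rcases eq_or_ne (p.1 ^ 2 + p.2 ^ 2) 0 with h | h
    · simp [h]
    · rw [mul_div_mul_right _ _ h]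
end

section
/- Fix κ>0 and define for (t,k,ξ) ∈ ℝ×ℝ×ℝ: 𝓜₃(t,k,ξ) = ∫_ℝ ⟨1/l⟩^{-1-κ} |l|^{-2} ( sgn(l)·arctan( (ξ + t(k−l)) / (1+|k−l|+|l|) ) + π/2 ) dl and Υ(t,k,ξ) = ∫_ℝ ⟨1/l⟩^{-1-κ} |l|^{-1} (1+|k−l|+|l|) / ( (1+|k−l|+|l|)² + (ξ + t(k−l))² ) dl. Then for every fixed (t,k,ξ), 𝓜₃ is differentiable in t and ξ and satisfies the transport identity (−∂_t + k ∂_ξ) 𝓜₃(t,k,ξ) = Υ(t,k,ξ). -/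
open MeasureTheory Real

lemma one_le_japInv (l : ℝ) : 1 ≤ japInv l :=
  Real.one_le_sqrt.mpr (by nlinarith [sq_nonneg l⁻¹])

lemma abs_inv_le_japInv (l : ℝ) : |l|⁻¹ ≤ japInv l := by
  rw [← abs_inv]
  exact Real.abs_le_sqrt (by linarith)

lemma measurable_japInv : Measurable japInv := by
  unfold japInv
  fun_prop

lemma Real.measurable_sign : Measurable Real.sign := by
  unfold Real.sign
  exact Measurable.ite measurableSet_Iio measurable_const
    (Measurable.ite measurableSet_Ioi measurable_const measurable_const)

lemma Real.abs_sign_le_one (x : ℝ) : |Real.sign x| ≤ 1 := by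
  rcases Real.sign_apply_eq x with h | h | h <;> simp [h]

/-- The weight `⟨1/l⟩^{-1-κ}|l|^{-2}` of the echo multiplier. -/
noncomputable def echoWeight (κ l : ℝ) : ℝ := japInv l ^ (-(1 + κ)) * (|l| ^ 2)⁻¹

lemma echoWeight_nonneg (κ l : ℝ) : 0 ≤ echoWeight κ l :=
  mul_nonneg (Real.rpow_nonneg (zero_le_one.trans (one_le_japInv l)) _) (by positivity)

lemma measurable_echoWeight (κ : ℝ) : Measurable (echoWeight κ) := by
  unfold echoWeight
  have := measurable_japInv
  fun_prop

lemma echoWeight_neg (κ l : ℝ) : echoWeight κ (-l) = echoWeight κ l := by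
  simp [echoWeight, japInv]

lemma echoWeight_le_rpow_sub_one {κ l : ℝ} (hκ : 0 < κ) (hl : 0 < l) :
    echoWeight κ l ≤ l ^ (κ - 1) := by
  have h : japInv l ^ (-(1 + κ)) ≤ l⁻¹ ^ (-(1 + κ)) :=
    Real.rpow_le_rpow_of_nonpos (inv_pos.mpr hl)
      (by simpa [abs_of_pos hl] using abs_inv_le_japInv l) (by linarith)
  calc echoWeight κ l ≤ l⁻¹ ^ (-(1 + κ)) * (|l| ^ 2)⁻¹ :=
        mul_le_mul_of_nonneg_right h (by positivity)
    _ = l ^ (κ - 1) := by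
        rw [Real.inv_rpow hl.le, Real.rpow_neg hl.le, inv_inv, sq_abs, ← Real.rpow_natCast,
          ← Real.rpow_neg hl.le, ← Real.rpow_add hl]
        congr 1
        push_cast
        ring

lemma echoWeight_le_rpow_neg_two {κ l : ℝ} (hκ : 0 < κ) (hl : 0 < l) :
    echoWeight κ l ≤ l ^ (-2 : ℝ) := by
  have h : japInv l ^ (-(1 + κ)) ≤ 1 :=
    Real.rpow_le_one_of_one_le_of_nonpos (one_le_japInv l) (by linarith)
  calc echoWeight κ l ≤ 1 * (|l| ^ 2)⁻¹ := mul_le_mul_of_nonneg_right h (by positivity)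
    _ = l ^ (-2 : ℝ) := by
        rw [Real.rpow_neg hl.le, one_mul, sq_abs, ← Real.rpow_natCast]
        norm_num

lemma integrable_echoWeight {κ : ℝ} (hκ : 0 < κ) : Integrable (echoWeight κ) := by
  have h01 : IntegrableOn (echoWeight κ) (Set.Ioc 0 1) := by
    have h := (intervalIntegral.intervalIntegrable_rpow' (a := 0) (b := 1)
      (show -1 < κ - 1 by linarith)).1
    refine Integrable.mono' h (measurable_echoWeight κ).aestronglyMeasurable ?_
    refine (ae_restrict_iff' measurableSet_Ioc).mpr (Filter.Eventually.of_forall fun l hl => ?_)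
    rw [Real.norm_of_nonneg (echoWeight_nonneg κ l)]
    exact echoWeight_le_rpow_sub_one hκ hl.1
  have h1 : IntegrableOn (echoWeight κ) (Set.Ioi 1) := by
    have h := integrableOn_Ioi_rpow_of_lt (show (-2 : ℝ) < -1 by norm_num) zero_lt_one
    refine Integrable.mono' h (measurable_echoWeight κ).aestronglyMeasurable ?_
    refine (ae_restrict_iff' measurableSet_Ioi).mpr (Filter.Eventually.of_forall fun l hl => ?_)
    rw [Real.norm_of_nonneg (echoWeight_nonneg κ l)]
    exact echoWeight_le_rpow_neg_two hκ (zero_lt_one.trans hl)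
  have hpos : IntegrableOn (echoWeight κ) (Set.Ioi 0) := by
    rw [← Set.Ioc_union_Ioi_eq_Ioi zero_le_one]
    exact h01.union h1
  have hneg : IntegrableOn (echoWeight κ) (Set.Iic 0) := by
    rw [integrableOn_Iic_iff_integrableOn_Iio]
    have h := (Measure.measurePreserving_neg (volume : Measure ℝ)).integrableOn_comp_preimage
      (Homeomorph.neg ℝ).measurableEmbedding |>.mpr hpos
    simpa [Function.comp_def, echoWeight_neg] using h
  rw [← integrableOn_univ, ← Set.Iic_union_Ioi (a := (0 : ℝ))]
  exact hneg.union hpos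

lemma hasDerivAt_arctan_affine_div (a b s : ℝ) {d : ℝ} (hd : 0 < d) :
    HasDerivAt (fun x => Real.arctan ((a + x * b) / d)) (b * d / (d ^ 2 + (a + s * b) ^ 2)) s := by
  have h := ((((hasDerivAt_id s).mul_const b).const_add a).div_const d).arctan
  convert h using 1
  have : 0 < d ^ 2 + (a + s * b) ^ 2 := by positivity
  simp only [id_eq]
  field_simp
  simp only [id_eq]

/-- Differentiation under the integral sign against a weight, for the arctangent of an affine
function whose slope is dominated by the denominator. -/
lemma hasDerivAt_integral_mul_sign_mul_arctan {w A B D : ℝ → ℝ} (hw : Integrable w)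
    (hA : Measurable A) (hB : Measurable B) (hD : Measurable D) (hD1 : ∀ l, 1 ≤ D l)
    (hBD : ∀ l, |B l| ≤ D l) (s : ℝ) :
    Integrable (fun l => w l *
      (Real.sign l * (B l * D l / (D l ^ 2 + (A l + s * B l) ^ 2)))) ∧
    HasDerivAt (fun x => ∫ l, w l * (Real.sign l * Real.arctan ((A l + x * B l) / D l) + π / 2))
      (∫ l, w l * (Real.sign l * (B l * D l / (D l ^ 2 + (A l + s * B l) ^ 2)))) s := by
  have hsign := Real.measurable_sign
  have hDpos : ∀ l, 0 < D l := fun l => zero_lt_one.trans_le (hD1 l)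
  have hmeas : ∀ x, Measurable
      fun l => Real.sign l * Real.arctan ((A l + x * B l) / D l) + π / 2 := by
    intro x
    fun_prop
  have hmeas' : Measurable
      fun l => Real.sign l * (B l * D l / (D l ^ 2 + (A l + s * B l) ^ 2)) := by
    fun_prop
  refine hasDerivAt_integral_of_dominated_loc_of_deriv_le (bound := fun l => ‖w l‖)
    (F' := fun x l => w l * (Real.sign l * (B l * D l / (D l ^ 2 + (A l + x * B l) ^ 2))))
    Filter.univ_mem
    (Filter.Eventually.of_forall fun x => hw.1.mul (hmeas x).aestronglyMeasurable)
    ?_ (hw.1.mul hmeas'.aestronglyMeasurable) ?_ hw.norm ?_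
  · refine hw.mul_bdd (c := π) (hmeas s).aestronglyMeasurable
      (Filter.Eventually.of_forall fun l => ?_)
    have h1 : |Real.arctan ((A l + s * B l) / D l)| ≤ π / 2 :=
      abs_le.mpr ⟨(Real.neg_pi_div_two_lt_arctan _).le, (Real.arctan_lt_pi_div_two _).le⟩
    have h2 : |Real.sign l * Real.arctan ((A l + s * B l) / D l)| ≤ π / 2 := by
      rw [abs_mul]
      exact (mul_le_of_le_one_left (abs_nonneg _) (Real.abs_sign_le_one l)).trans h1
    rw [Real.norm_eq_abs]
    have := abs_le.mp h2
    exact abs_le.mpr ⟨by linarith [Real.pi_pos], by linarith⟩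
  · refine Filter.Eventually.of_forall fun l x _ => ?_
    have hpos : 0 < D l ^ 2 + (A l + x * B l) ^ 2 := by
      have := hDpos l
      positivity
    have h1 : |B l * D l / (D l ^ 2 + (A l + x * B l) ^ 2)| ≤ 1 := by
      rw [abs_div, abs_of_pos hpos, div_le_one hpos, abs_mul, abs_of_pos (hDpos l)]
      nlinarith [hBD l, hDpos l, sq_nonneg (A l + x * B l)]
    rw [norm_mul, norm_mul]
    refine mul_le_of_le_one_right (norm_nonneg _) ?_
    exact mul_le_one₀ (Real.abs_sign_le_one l) (norm_nonneg _) h1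
  · refine Filter.Eventually.of_forall fun l x _ => ?_
    exact (((hasDerivAt_arctan_affine_div _ _ _ (hDpos l)).const_mul _).add_const _).const_mul _

/-- The echo multiplier `𝓜₃` is differentiable in `t` and `ξ` and satisfies the
transport identity `(−∂ₜ + k∂_ξ)𝓜₃ = Υ`. -/
theorem M3_transport_identity (κ : ℝ) (hκ : 0 < κ) (t k ξ : ℝ) :
    DifferentiableAt ℝ (fun s => M3 κ s k ξ) t ∧
    DifferentiableAt ℝ (fun ξ' => M3 κ t k ξ') ξ ∧
    -(deriv (fun s => M3 κ s k ξ) t) + k * deriv (fun ξ' => M3 κ t k ξ') ξ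
      = Upsilon κ t k ξ := by
  set D : ℝ → ℝ := fun l => 1 + |k - l| + |l| with hDdef
  have hD : Measurable D := by fun_prop
  have hD1 : ∀ l, 1 ≤ D l := fun l => by
    simp only [hDdef]
    linarith [abs_nonneg (k - l), abs_nonneg l]
  have hBD : ∀ l, |k - l| ≤ D l := fun l => by
    simp only [hDdef]
    linarith [abs_nonneg l]
  obtain ⟨hti, ht⟩ := hasDerivAt_integral_mul_sign_mul_arctan (integrable_echoWeight hκ)
    (A := fun _ => ξ) (B := fun l => k - l) measurable_const (by fun_prop) hD hD1 hBD t
  obtain ⟨hxi, hx⟩ := hasDerivAt_integral_mul_sign_mul_arctan (integrable_echoWeight hκ)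
    (A := fun l => t * (k - l)) (B := fun _ => 1) (by fun_prop) measurable_const hD hD1
    (by simpa using hD1) ξ
  have ht' : HasDerivAt (fun s => M3 κ s k ξ) _ t := ht
  have hM3 : (fun ξ' => M3 κ t k ξ') = fun x => ∫ l, echoWeight κ l *
      (Real.sign l * Real.arctan ((t * (k - l) + x * 1) / D l) + π / 2) := by
    funext x
    simp only [M3, echoWeight, mul_one, add_comm x, hDdef]
  have hx' := hM3 ▸ hx
  refine ⟨ht'.differentiableAt, hx'.differentiableAt, ?_⟩
  rw [ht'.deriv, hx'.deriv, neg_add_eq_sub, ← integral_const_mul,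
    ← integral_sub (hxi.const_mul k) hti, Upsilon]
  refine integral_congr_ae (Filter.Eventually.of_forall fun l => ?_)
  simp only [echoWeight, hDdef, mul_one, add_comm _ ξ]
  rcases eq_or_ne l 0 with rfl | hl
  · simp
  have habs : |l| ≠ 0 := abs_ne_zero.mpr hl
  have hsign : Real.sign l * l = |l| := by
    rcases lt_or_gt_of_ne hl with h | h
    · simp [Real.sign_of_neg h, abs_of_neg h]
    · simp [Real.sign_of_pos h, abs_of_pos h]
  have hinv : |l|⁻¹ = (|l| ^ 2)⁻¹ * (Real.sign l * l) := by
    rw [hsign]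
    field_simp
  rw [hinv]
  ring
end

section
/- There exist absolute constants C,c>0 such that for all 0<ν≤1, all t≥0 and all (k,ξ)∈ℝ² with k≠0, the stream function of Kelvin's solution, φ̂(t,k,ξ) = −ŵ(t,k,ξ)/(k²+ξ²) with ŵ(t,k,ξ) = ω̂_in(k,ξ+kt)·exp(−ν∫₀^t(k²+(ξ+k(t−s))²)ds), satisfies the inviscid damping bound |φ̂(t,k,ξ)| ≤ C ⟨t⟩^{−2} · (1+k²+(ξ+kt)²)/k⁴ · |ω̂_in(k,ξ+kt)| e^{−cν^{1/3}|k|^{2/3}t}. -/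
open MeasureTheory Real

/-- The time integral of the dissipation symbol along the Couette characteristic. -/
lemma integral_dissipation_symbol (t k ξ : ℝ) :
    ∫ s in (0:ℝ)..t, (k ^ 2 + (ξ + k * (t - s)) ^ 2) =
      k ^ 2 * t + ξ ^ 2 * t + ξ * k * t ^ 2 + k ^ 2 * t ^ 3 / 3 := by
  rw [intervalIntegral.integral_eq_sub_of_hasDerivAt
    (f := fun s => k ^ 2 * s + (ξ + k * t) ^ 2 * s - (ξ + k * t) * k * s ^ 2 + k ^ 2 * s ^ 3 / 3)]
  · ring
  · intro s _
    have h := ((((hasDerivAt_id s).const_mul (k ^ 2)).add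
      ((hasDerivAt_id s).const_mul ((ξ + k * t) ^ 2))).sub
      ((hasDerivAt_pow 2 s).const_mul ((ξ + k * t) * k))).add
      (((hasDerivAt_pow 3 s).const_mul (k ^ 2)).div_const 3)
    refine HasDerivAt.congr_deriv h ?_
    push_cast
    ring
  · exact Continuous.intervalIntegrable (by fun_prop) _ _

/-- Enhanced dissipation: the time integral of the symbol controls `ν^{1/3}|k|^{2/3}t`. -/
lemma enhanced_dissipation_lower_bound {ν t : ℝ} (hν : 0 ≤ ν) (ht : 0 ≤ t) (k ξ : ℝ) :
    ν ^ ((1:ℝ)/3) * |k| ^ ((2:ℝ)/3) * t - 4 / 3 ≤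
      ν * ∫ s in (0:ℝ)..t, (k ^ 2 + (ξ + k * (t - s)) ^ 2) := by
  rw [integral_dissipation_symbol]
  set a := ν ^ ((1:ℝ)/3) * |k| ^ ((2:ℝ)/3)
  have ha : 0 ≤ a := by positivity
  have ha3 : a ^ 3 = ν * k ^ 2 := by
    rw [mul_pow, ← Real.rpow_mul_natCast hν, ← Real.rpow_mul_natCast (abs_nonneg k), ← sq_abs k,
      ← Real.rpow_natCast |k| 2]
    norm_num
  have hcubic : a * t - 4 / 3 ≤ (a * t) ^ 3 / 12 := by
    nlinarith [mul_nonneg (sq_nonneg (a * t - 2)) (by positivity : 0 ≤ a * t + 4)]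
  have hcube : (a * t) ^ 3 = ν * (k ^ 2 * t ^ 3) := by rw [mul_pow, ha3]; ring
  have hsq : 0 ≤ ν * (k ^ 2 * t + t * (ξ + k * t / 2) ^ 2) := by positivity
  linarith

/-- Inviscid damping: inverting the Laplacian gains `⟨t⟩⁻²` at the cost of two derivatives. -/
lemma inv_laplacian_symbol_le (t ξ : ℝ) {k : ℝ} (hk : k ≠ 0) :
    (k ^ 2 + ξ ^ 2)⁻¹ ≤
      3 * (jap t ^ 2)⁻¹ * ((1 + k ^ 2 + (ξ + k * t) ^ 2) / k ^ 4) := by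
  have hjap : jap t ^ 2 = 1 + t ^ 2 := Real.sq_sqrt (by positivity)
  rw [hjap, ← div_eq_mul_inv, div_mul_div_comm, inv_eq_one_div,
    div_le_div_iff₀ (by positivity) (by positivity)]
  nlinarith [mul_nonneg (sq_nonneg k) (sq_nonneg (2 * ξ + k * t)), sq_nonneg (k * ξ),
    sq_nonneg (k * (ξ + k * t)), sq_nonneg (ξ * (ξ + k * t)), sq_nonneg k, sq_nonneg ξ,
    sq_nonneg (k ^ 2)]

/-- Inviscid damping for the stream function of Kelvin's solution
`φ̂ = −ŵ/(k²+ξ²)`: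
`|φ̂(t,k,ξ)| ≤ C⟨t⟩^{−2}(1+k²+(ξ+kt)²)/k⁴·|ω̂_in(k,ξ+kt)|e^{−cν^{1/3}|k|^{2/3}t}`. -/
theorem kelvin_inviscid_damping :
    ∃ C c : ℝ, 0 < C ∧ 0 < c ∧
      ∀ ν : ℝ, 0 < ν → ν ≤ 1 → ∀ t : ℝ, 0 ≤ t → ∀ k ξ : ℝ, k ≠ 0 →
      ∀ win : ℝ × ℝ → ℂ,
        ‖-kelvin ν win t (k, ξ) / ((k ^ 2 + ξ ^ 2 : ℝ) : ℂ)‖ ≤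
          C * (jap t ^ 2)⁻¹ * ((1 + k ^ 2 + (ξ + k * t) ^ 2) / k ^ 4) *
            ‖win (k, ξ + k * t)‖ *
            Real.exp (-(c * ν ^ ((1:ℝ)/3) * |k| ^ ((2:ℝ)/3) * t)) := by
  refine ⟨3 * Real.exp (4 / 3), 1, by positivity, one_pos, ?_⟩
  intro ν hν _ t ht k ξ hk win
  have hlap := inv_laplacian_symbol_le t ξ hk
  have hexp : Real.exp (-(ν * ∫ s in (0:ℝ)..t, (k ^ 2 + (ξ + k * (t - s)) ^ 2))) ≤
      Real.exp (4 / 3) * Real.exp (-(1 * ν ^ ((1:ℝ)/3) * |k| ^ ((2:ℝ)/3) * t)) := by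
    rw [← Real.exp_add, Real.exp_le_exp]
    linarith [enhanced_dissipation_lower_bound hν.le ht k ξ]
  rw [norm_div, norm_neg, kelvin, norm_mul, Complex.norm_real, Complex.norm_real,
    Real.norm_of_nonneg (Real.exp_nonneg _), Real.norm_of_nonneg (by positivity), div_eq_mul_inv]
  calc _ ≤ ‖win (k, ξ + k * t)‖ *
        (Real.exp (4 / 3) * Real.exp (-(1 * ν ^ ((1:ℝ)/3) * |k| ^ ((2:ℝ)/3) * t))) *
        (3 * (jap t ^ 2)⁻¹ * ((1 + k ^ 2 + (ξ + k * t) ^ 2) / k ^ 4)) := by gcongr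
    _ = _ := by ring
end

section
/- There exists an absolute constant C>0 such that for all real l≠0, η and t: 1/(l²+η²) ≤ C (1 + l² + (η+lt)²) / ( l⁴ (1+t²) ), and consequently 1/(l²+η²) ≤ C (1+t²)^{-1} (1+l^{-2})² (1 + l² + (η+lt)²). -/
open MeasureTheory Real

/-- The polynomial form of the inviscid damping inequality. -/
theorem pow_four_mul_one_add_sq_le (l η t : ℝ) :
    l ^ 4 * (1 + t ^ 2) ≤ 3 * (1 + l ^ 2 + (η + l * t) ^ 2) * (l ^ 2 + η ^ 2) := by
  have h : l ^ 2 * t ^ 2 ≤ 2 * (η + l * t) ^ 2 + 2 * η ^ 2 := by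
    nlinarith [sq_nonneg (2 * η + l * t)]
  have h_mul := mul_le_mul_of_nonneg_left h (sq_nonneg l)
  have h₁ : 0 ≤ l ^ 2 * (η + l * t) ^ 2 := by positivity
  have h₂ : 0 ≤ l ^ 2 * η ^ 2 := by positivity
  have h₃ : 0 ≤ η ^ 2 * (η + l * t) ^ 2 := by positivity
  nlinarith [sq_nonneg l, sq_nonneg η, sq_nonneg (l ^ 2)]

/-- Pointwise inviscid damping inequality: there is an absolute constant `C>0` such that
for all `l ≠ 0`, `η`, `t`,
`1/(l²+η²) ≤ C(1+l²+(η+lt)²)/(l⁴(1+t²))` and consequently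
`1/(l²+η²) ≤ C(1+t²)⁻¹(1+l⁻²)²(1+l²+(η+lt)²)`. -/
theorem pointwise_inviscid_damping :
    ∃ C : ℝ, 0 < C ∧ ∀ l η t : ℝ, l ≠ 0 →
      1 / (l ^ 2 + η ^ 2) ≤ C * (1 + l ^ 2 + (η + l * t) ^ 2) / (l ^ 4 * (1 + t ^ 2)) ∧
      1 / (l ^ 2 + η ^ 2) ≤
        C * (1 + t ^ 2)⁻¹ * (1 + (l⁻¹) ^ 2) ^ 2 * (1 + l ^ 2 + (η + l * t) ^ 2) := by
  refine ⟨3, by norm_num, fun l η t hl => ?_⟩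
  have h_first : 1 / (l ^ 2 + η ^ 2) ≤
      3 * (1 + l ^ 2 + (η + l * t) ^ 2) / (l ^ 4 * (1 + t ^ 2)) := by
    rw [div_le_div_iff₀ (by positivity) (by positivity), one_mul]
    exact pow_four_mul_one_add_sq_le l η t
  refine ⟨h_first, h_first.trans ?_⟩
  have h_weight : ((l⁻¹) ^ 2) ^ 2 ≤ (1 + (l⁻¹) ^ 2) ^ 2 := by
    gcongr
    linarith
  calc 3 * (1 + l ^ 2 + (η + l * t) ^ 2) / (l ^ 4 * (1 + t ^ 2))
      = 3 * (1 + t ^ 2)⁻¹ * ((l⁻¹) ^ 2) ^ 2 * (1 + l ^ 2 + (η + l * t) ^ 2) := by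
        field_simp
    _ ≤ 3 * (1 + t ^ 2)⁻¹ * (1 + (l⁻¹) ^ 2) ^ 2 * (1 + l ^ 2 + (η + l * t) ^ 2) := by
        gcongr
end

section
/- Let 0<δ<1. There exists a constant C>0 such that for all real l, η, t: |l| + |η+lt| ≤ C ⟨l, η+lt⟩^{1−δ} ⟨t⟩^{δ} ( |l| + |η| )^{δ}, where ⟨a,b⟩=(1+a²+b²)^{1/2} and ⟨t⟩=(1+t²)^{1/2}. -/
open MeasureTheory Real

lemma one_le_jap (a : ℝ) : 1 ≤ jap a :=
  Real.one_le_sqrt.mpr (by nlinarith [sq_nonneg a])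

lemma abs_le_jap (a : ℝ) : |a| ≤ jap a :=
  Real.abs_le_sqrt (by linarith)

lemma abs_add_abs_le_two_mul_jap2 (a b : ℝ) : |a| + |b| ≤ 2 * jap2 a b := by
  have ha : |a| ≤ jap2 a b := Real.abs_le_sqrt (by nlinarith [sq_nonneg b])
  have hb : |b| ≤ jap2 a b := Real.abs_le_sqrt (by nlinarith [sq_nonneg a])
  linarith

/-- The moving-frame frequency is controlled by time and the physical frequency. -/
lemma abs_add_abs_shear_le (l η t : ℝ) :
    |l| + |η + l * t| ≤ 2 * (jap t * (|l| + |η|)) := by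
  have h : |η + l * t| ≤ |η| + |l| * |t| := (abs_add_le _ _).trans_eq (by rw [abs_mul])
  have hl := mul_le_mul_of_nonneg_left (abs_le_jap t) (abs_nonneg l)
  have hl' := mul_le_mul_of_nonneg_left (one_le_jap t) (abs_nonneg l)
  have hη := mul_le_mul_of_nonneg_left (one_le_jap t) (abs_nonneg η)
  have hη' := mul_nonneg (abs_nonneg η) (zero_le_one.trans (one_le_jap t))
  linarith

/-- Frequency–time interpolation inequality:
`|l| + |η+lt| ≤ C ⟨l, η+lt⟩^{1−δ} ⟨t⟩^δ (|l|+|η|)^δ` for `0 < δ < 1`. -/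
theorem frequency_time_interpolation (δ : ℝ) (h0 : 0 < δ) (h1 : δ < 1) :
    ∃ C : ℝ, 0 < C ∧ ∀ l η t : ℝ,
      |l| + |η + l * t| ≤
        C * jap2 l (η + l * t) ^ (1 - δ) * jap t ^ δ * (|l| + |η|) ^ δ := by
  refine ⟨2, two_pos, fun l η t => ?_⟩
  have hJ : 0 ≤ jap2 l (η + l * t) := Real.sqrt_nonneg _
  have hT : 0 ≤ jap t := Real.sqrt_nonneg _
  have hB : 0 ≤ |l| + |η| := by positivity
  have hA : 0 ≤ |l| + |η + l * t| := by positivity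
  calc |l| + |η + l * t|
      = (|l| + |η + l * t|) ^ (1 - δ) * (|l| + |η + l * t|) ^ δ := by
        rw [← Real.rpow_add_of_nonneg hA (by linarith) h0.le, sub_add_cancel, Real.rpow_one]
    _ ≤ (2 * jap2 l (η + l * t)) ^ (1 - δ) * (2 * (jap t * (|l| + |η|))) ^ δ :=
        mul_le_mul
          (Real.rpow_le_rpow hA (abs_add_abs_le_two_mul_jap2 _ _) (by linarith))
          (Real.rpow_le_rpow hA (abs_add_abs_shear_le l η t) h0.le)
          (by positivity) (by positivity)
    _ = ((2 : ℝ) ^ (1 - δ) * 2 ^ δ) * jap2 l (η + l * t) ^ (1 - δ) * jap t ^ δ *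
          (|l| + |η|) ^ δ := by
        rw [Real.mul_rpow two_pos.le hJ, Real.mul_rpow two_pos.le (mul_nonneg hT hB),
          Real.mul_rpow hT hB]
        ring
    _ = 2 * jap2 l (η + l * t) ^ (1 - δ) * jap t ^ δ * (|l| + |η|) ^ δ := by
        rw [← Real.rpow_add two_pos, sub_add_cancel, Real.rpow_one]
end

section
/- Let 0<δ<1, (1−δ)/2 < ε < 1/2, and 0 < κ < 2ε/(1−δ) − 1. There exists a constant C>0 such that for all t ≥ 0 and all (k,ξ) ∈ ℝ²: ∫_{ℝ²} ⟨1/l⟩^{−2ε} / ( (l²+η²) · (1 + (k−l)² + (ξ−η+(k−l)t)²) ) dη dl ≤ C · Υ(t,k,ξ)^{1−δ}, where Υ(t,k,ξ) = ∫_ℝ ⟨1/l⟩^{−1−κ} |l|^{−1} (1+|k−l|+|l|) / ( (1+|k−l|+|l|)² + (ξ+t(k−l))² ) dl and ⟨1/l⟩ = (1+l^{-2})^{1/2}. -/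
open MeasureTheory Real

lemma japInv_pos (l : ℝ) : 0 < japInv l := one_pos.trans_le (one_le_japInv l)

lemma japInv_rpow_neg_le_one {s : ℝ} (hs : 0 < s) (l : ℝ) : japInv l ^ (-s) ≤ 1 :=
  Real.rpow_le_one_of_one_le_of_nonpos (one_le_japInv l) (by linarith)

lemma japInv_rpow_neg_le {s : ℝ} (hs : 0 < s) {l : ℝ} (hl : l ≠ 0) :
    japInv l ^ (-s) ≤ |l| ^ s := by
  have h1 : |l|⁻¹ ≤ japInv l := by
    rw [← abs_inv]
    exact Real.abs_le_sqrt (by linarith)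
  have hl' : 0 < |l| := abs_pos.mpr hl
  calc japInv l ^ (-s) ≤ (|l|⁻¹) ^ (-s) :=
        Real.rpow_le_rpow_of_nonpos (by positivity) h1 (by linarith)
    _ = |l| ^ s := by rw [Real.inv_rpow hl'.le, Real.rpow_neg hl'.le, inv_inv]

/-- The majorant `⟨1/l⟩^{-s} |l|⁻¹ (1+|l|)⁻¹` is integrable on the line for `s > 0`. -/
lemma integrable_japInv_rpow_mul_inv {s : ℝ} (hs : 0 < s) :
    Integrable (fun l : ℝ => japInv l ^ (-s) * |l|⁻¹ * (1 + |l|)⁻¹) := by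
  set h : ℝ → ℝ := Set.indicator (Set.Ioc 0 1) (fun x => x ^ (s - 1)) with hh
  have hint : Integrable h := by
    rw [hh, integrable_indicator_iff measurableSet_Ioc,
      ← intervalIntegrable_iff_integrableOn_Ioc_of_le zero_le_one]
    exact intervalIntegral.intervalIntegrable_rpow' (by linarith)
  have h0 : ∀ x, 0 ≤ h x := fun x =>
    Set.indicator_nonneg (fun y hy => Real.rpow_nonneg hy.1.le _) x
  have hmaj := (hint.add hint.comp_neg).add (integrable_inv_one_add_sq.const_mul 2)
  refine hmaj.mono' ?_ ?_
  · have := measurable_japInv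
    exact Measurable.aestronglyMeasurable (by fun_prop)
  · have hne : ∀ᵐ l : ℝ, l ≠ 0 := by simp [ae_iff]
    filter_upwards [hne] with l hl
    have hl' : 0 < |l| := abs_pos.mpr hl
    have hj := Real.rpow_nonneg (japInv_pos l).le (-s)
    rw [Real.norm_of_nonneg (by positivity)]
    simp only [Pi.add_apply]
    rcases le_total |l| 1 with h1 | h1
    · have e : japInv l ^ (-s) * |l|⁻¹ * (1 + |l|)⁻¹ ≤ |l| ^ (s - 1) := by
        rw [Real.rpow_sub_one hl'.ne', div_eq_mul_inv]
        have : (1 + |l|)⁻¹ ≤ 1 := inv_le_one_of_one_le₀ (by linarith)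
        calc _ ≤ japInv l ^ (-s) * |l|⁻¹ * 1 := by gcongr
          _ ≤ _ := by
            rw [mul_one]
            gcongr
            exact japInv_rpow_neg_le hs hl
      have e2 : |l| ^ (s - 1) ≤ h l + h (-l) := by
        rcases lt_or_gt_of_ne hl with hn | hp
        · have : h (-l) = |l| ^ (s - 1) := by
            rw [abs_of_neg hn] at h1 ⊢
            exact Set.indicator_of_mem (Set.mem_Ioc.mpr ⟨by linarith, h1⟩) _
          linarith [h0 l]
        · have : h l = |l| ^ (s - 1) := by
            rw [abs_of_pos hp] at h1 ⊢
            exact Set.indicator_of_mem (Set.mem_Ioc.mpr ⟨hp, h1⟩) _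
          linarith [h0 (-l)]
      have : 0 ≤ 2 * (1 + l ^ 2)⁻¹ := by positivity
      linarith
    · have e : japInv l ^ (-s) * |l|⁻¹ * (1 + |l|)⁻¹ ≤ 2 * (1 + l ^ 2)⁻¹ := by
        calc _ ≤ 1 * |l|⁻¹ * (1 + |l|)⁻¹ := by
              gcongr
              exact japInv_rpow_neg_le_one hs l
          _ = 1 / (|l| * (1 + |l|)) := by field_simp
          _ ≤ 2 / (1 + l ^ 2) := by
              rw [div_le_div_iff₀ (by positivity) (by positivity), ← sq_abs l]
              nlinarith
          _ = _ := by rw [div_eq_mul_inv]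
      linarith [h0 l, h0 (-l)]

/-- The Poisson-type kernel `M / (M² + A²)` with `M = 1 + |k-l| + |l|`, `A = ξ + t(k-l)`. -/
noncomputable def echoKernel (t k ξ l : ℝ) : ℝ :=
  (1 + |k - l| + |l|) / ((1 + |k - l| + |l|) ^ 2 + (ξ + t * (k - l)) ^ 2)

lemma measurable_echoKernel (t k ξ : ℝ) : Measurable (echoKernel t k ξ) := by
  unfold echoKernel
  fun_prop

lemma echoKernel_nonneg (t k ξ l : ℝ) : 0 ≤ echoKernel t k ξ l := by
  unfold echoKernel
  positivity

lemma echoKernel_le (t k ξ l : ℝ) : echoKernel t k ξ l ≤ (1 + |l|)⁻¹ := by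
  have h1 := abs_nonneg (k - l)
  have h2 := abs_nonneg l
  rw [echoKernel, ← one_div, div_le_div_iff₀ (by positivity) (by positivity)]
  nlinarith [sq_nonneg (ξ + t * (k - l)), mul_nonneg h1 h1, mul_nonneg h1 h2]

lemma echoIntegrand_nonneg (s t k ξ l : ℝ) :
    0 ≤ japInv l ^ (-s) * |l|⁻¹ * echoKernel t k ξ l := by
  have := Real.rpow_nonneg (japInv_pos l).le (-s)
  have := echoKernel_nonneg t k ξ l
  positivity

lemma echoIntegrand_le (s t k ξ l : ℝ) :
    japInv l ^ (-s) * |l|⁻¹ * echoKernel t k ξ l ≤ japInv l ^ (-s) * |l|⁻¹ * (1 + |l|)⁻¹ := by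
  have := Real.rpow_nonneg (japInv_pos l).le (-s)
  gcongr
  exact echoKernel_le t k ξ l

lemma measurable_echoIntegrand (s t k ξ : ℝ) :
    Measurable (fun l : ℝ => japInv l ^ (-s) * |l|⁻¹ * echoKernel t k ξ l) := by
  have := measurable_japInv
  have := measurable_echoKernel t k ξ
  fun_prop

lemma integrable_echoIntegrand {s : ℝ} (hs : 0 < s) (t k ξ : ℝ) :
    Integrable (fun l : ℝ => japInv l ^ (-s) * |l|⁻¹ * echoKernel t k ξ l) := by
  refine (integrable_japInv_rpow_mul_inv hs).mono'
    (measurable_echoIntegrand s t k ξ).aestronglyMeasurable (ae_of_all _ fun l => ?_)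
  rw [Real.norm_of_nonneg (echoIntegrand_nonneg s t k ξ l)]
  exact echoIntegrand_le s t k ξ l

lemma integrable_inv_sq_add_sq {b : ℝ} (hb : 0 < b) :
    Integrable (fun x : ℝ => (b ^ 2 + x ^ 2)⁻¹) := by
  have := ((integrable_inv_one_add_sq.comp_mul_left' (inv_ne_zero hb.ne')).const_mul (b ^ 2)⁻¹)
  refine this.congr (ae_of_all _ fun x => ?_)
  field_simp

lemma integral_univ_inv_sq_add_sq {b : ℝ} (hb : 0 < b) :
    ∫ x : ℝ, (b ^ 2 + x ^ 2)⁻¹ = π / b := by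
  have h := Measure.integral_comp_mul_left (fun x : ℝ => (1 + x ^ 2)⁻¹) b⁻¹
  rw [integral_univ_inv_one_add_sq, inv_inv, abs_of_pos hb] at h
  have e : ∀ x : ℝ, (b ^ 2 + x ^ 2)⁻¹ = (b ^ 2)⁻¹ * (1 + (b⁻¹ * x) ^ 2)⁻¹ := fun x => by
    field_simp
  simp_rw [e]
  rw [integral_const_mul, h, smul_eq_mul]
  field_simp

lemma inv_mul_inv_le_of_le_add {X Y D : ℝ} (hX : 0 < X) (hY : 0 < Y) (hD : 0 < D)
    (h : D ≤ 3 * (X + Y)) : 1 / (X * Y) ≤ 3 / D * (X⁻¹ + Y⁻¹) := by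
  have : 3 / D * (X⁻¹ + Y⁻¹) = (3 * (X + Y)) / D * (1 / (X * Y)) := by
    field_simp
    ring
  rw [this]
  exact le_mul_of_one_le_left (by positivity) ((one_le_div hD).mpr h)

/-- The `η`-convolution of the Biot–Savart symbol with the Poisson-type kernel. -/
lemma lintegral_biotSavart_conv_le (t k ξ : ℝ) {l : ℝ} (hl : l ≠ 0) :
    ∫⁻ η : ℝ, ENNReal.ofReal
        (1 / ((l ^ 2 + η ^ 2) * (1 + (k - l) ^ 2 + (ξ - η + (k - l) * t) ^ 2)))
      ≤ ENNReal.ofReal (3 * π * (|l|⁻¹ * echoKernel t k ξ l)) := by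
  have hl' : 0 < |l| := abs_pos.mpr hl
  set a := √(1 + (k - l) ^ 2) with ha
  have ha2 : a ^ 2 = 1 + (k - l) ^ 2 := Real.sq_sqrt (by positivity)
  have ha1 : 1 ≤ a := by rw [ha, Real.one_le_sqrt]; nlinarith [sq_nonneg (k - l)]
  have ha0 : 0 < a := by linarith
  have haM : a ≤ 1 + |k - l| := by
    rw [ha]
    apply Real.sqrt_le_iff.mpr ⟨by positivity, ?_⟩
    nlinarith [sq_abs (k - l), abs_nonneg (k - l)]
  set A := ξ + t * (k - l) with hA
  set D := (1 + |k - l| + |l|) ^ 2 + A ^ 2 with hD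
  have hD0 : 0 < D := by positivity
  have i1 : Integrable (fun η : ℝ => (|l| ^ 2 + η ^ 2)⁻¹) := integrable_inv_sq_add_sq hl'
  have i2 : Integrable (fun η : ℝ => (a ^ 2 + (A - η) ^ 2)⁻¹) :=
    (integrable_inv_sq_add_sq ha0).comp_sub_left A
  have e2 : ∫ η : ℝ, (a ^ 2 + (A - η) ^ 2)⁻¹ = π / a := by
    rw [← integral_univ_inv_sq_add_sq ha0]
    exact integral_sub_left_eq_self (fun x : ℝ => (a ^ 2 + x ^ 2)⁻¹) volume A
  calc _ ≤ ∫⁻ η : ℝ, ENNReal.ofReal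
        (3 / D * ((|l| ^ 2 + η ^ 2)⁻¹ + (a ^ 2 + (A - η) ^ 2)⁻¹)) := by
        refine lintegral_mono fun η => ENNReal.ofReal_le_ofReal ?_
        have hY : 1 + (k - l) ^ 2 + (ξ - η + (k - l) * t) ^ 2 = a ^ 2 + (A - η) ^ 2 := by
          rw [ha2, hA]; ring
        rw [hY, ← sq_abs l]
        refine inv_mul_inv_le_of_le_add (by positivity) (by positivity) hD0 ?_
        rw [hD, ha2, ← sq_abs (k - l)]
        nlinarith [sq_nonneg (1 - |k - l|), sq_nonneg (1 - |l|), sq_nonneg (|k - l| - |l|),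
          sq_nonneg (A - 2 * η), sq_nonneg (A - η), sq_nonneg η]
    _ = ENNReal.ofReal (3 / D * (π / |l| + π / a)) := by
        have i3 : Integrable (fun η : ℝ =>
            3 / D * ((|l| ^ 2 + η ^ 2)⁻¹ + (a ^ 2 + (A - η) ^ 2)⁻¹)) := (i1.add i2).const_mul _
        rw [← ofReal_integral_eq_lintegral_ofReal i3
          (ae_of_all _ fun η => by simp only [Pi.zero_apply]; positivity)]
        congr 1
        rw [integral_const_mul, integral_add i1 i2, integral_univ_inv_sq_add_sq hl', e2]
    _ ≤ _ := by
        apply ENNReal.ofReal_le_ofReal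
        have : π / |l| + π / a ≤ π * (|l|⁻¹ * (1 + |k - l| + |l|)) := by
          have : π / |l| + π / a = π * (|l|⁻¹ * ((a + |l|) / a)) := by field_simp
          rw [this]
          gcongr
          calc (a + |l|) / a ≤ (a + |l|) / 1 := by gcongr
            _ ≤ _ := by linarith
        calc _ ≤ 3 / D * (π * (|l|⁻¹ * (1 + |k - l| + |l|))) := by gcongr
          _ = _ := by rw [echoKernel, ← hA, ← hD]; ring

/-- Key reaction (echo) estimate: the Biot–Savart symbol convolved against a Poisson-type
kernel is bounded by the `(1−δ)` power of the dissipation symbol `Υ` of `𝓜₃`. -/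
theorem echo_reaction_estimate (δ ε κ : ℝ) (hδ0 : 0 < δ) (hδ1 : δ < 1)
    (hε1 : (1 - δ)/2 < ε) (hε2 : ε < 1/2)
    (hκ0 : 0 < κ) (hκ1 : κ < 2 * ε / (1 - δ) - 1) :
    ∃ C : ℝ, 0 < C ∧ ∀ t : ℝ, 0 ≤ t → ∀ k ξ : ℝ,
      (∫ q : ℝ × ℝ, japInv q.1 ^ (-(2 * ε)) /
          ((q.1 ^ 2 + q.2 ^ 2) * (1 + (k - q.1) ^ 2 + (ξ - q.2 + (k - q.1) * t) ^ 2)))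
        ≤ C * Upsilon κ t k ξ ^ (1 - δ) := by
  have hδ' : 0 < 1 - δ := by linarith
  set α : ℝ := (2 * ε - (1 - δ) * (1 + κ)) / δ with hα
  have hα0 : 0 < α := by
    have : 1 + κ < 2 * ε / (1 - δ) := by linarith
    rw [lt_div_iff₀ hδ'] at this
    exact div_pos (by linarith) hδ0
  have hexp : -(2 * ε) = -(1 + κ) * (1 - δ) + -α * δ := by
    rw [hα]
    field_simp
    ring
  set K : ℝ := ∫ l : ℝ, japInv l ^ (-α) * |l|⁻¹ * (1 + |l|)⁻¹ with hK
  have hK0 : 0 ≤ K := integral_nonneg fun l => by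
    have := Real.rpow_nonneg (japInv_pos l).le (-α)
    positivity
  refine ⟨3 * π * K ^ δ + 1, by positivity, fun t _ k ξ => ?_⟩
  have hU : Upsilon κ t k ξ = ∫ l : ℝ, japInv l ^ (-(1 + κ)) * |l|⁻¹ * echoKernel t k ξ l := rfl
  have hU0 : 0 ≤ Upsilon κ t k ξ := by
    rw [hU]
    exact integral_nonneg fun l => echoIntegrand_nonneg _ t k ξ l
  have hUl : ∫⁻ l : ℝ, ENNReal.ofReal (japInv l ^ (-(1 + κ)) * |l|⁻¹ * echoKernel t k ξ l)
      = ENNReal.ofReal (Upsilon κ t k ξ) := by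
    rw [hU, ofReal_integral_eq_lintegral_ofReal (integrable_echoIntegrand (by linarith) t k ξ)
      (ae_of_all _ fun l => echoIntegrand_nonneg _ t k ξ l)]
  have hKl : ∫⁻ l : ℝ, ENNReal.ofReal (japInv l ^ (-α) * |l|⁻¹ * echoKernel t k ξ l)
      ≤ ENNReal.ofReal K := by
    rw [hK, ofReal_integral_eq_lintegral_ofReal (integrable_japInv_rpow_mul_inv hα0)
      (ae_of_all _ fun l =>
        (echoIntegrand_nonneg α t k ξ l).trans (echoIntegrand_le α t k ξ l))]
    exact lintegral_mono fun l => ENNReal.ofReal_le_ofReal (echoIntegrand_le α t k ξ l)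
  have hmeas : Measurable (fun q : ℝ × ℝ => japInv q.1 ^ (-(2 * ε)) /
      ((q.1 ^ 2 + q.2 ^ 2) * (1 + (k - q.1) ^ 2 + (ξ - q.2 + (k - q.1) * t) ^ 2))) := by
    have := measurable_japInv
    fun_prop
  have hne : ∀ᵐ l : ℝ, l ≠ 0 := by simp [ae_iff]
  rw [integral_eq_lintegral_of_nonneg_ae _ hmeas.aestronglyMeasurable]
  swap
  · refine ae_of_all _ fun q => ?_
    have := Real.rpow_nonneg (japInv_pos q.1).le (-(2 * ε))
    simp only [Pi.zero_apply]
    positivity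
  apply ENNReal.toReal_le_of_le_ofReal (by positivity)
  rw [Measure.volume_eq_prod, lintegral_prod _ hmeas.ennreal_ofReal.aemeasurable]
  calc _ ≤ ∫⁻ l : ℝ, ENNReal.ofReal (3 * π) *
        (ENNReal.ofReal (japInv l ^ (-(1 + κ)) * |l|⁻¹ * echoKernel t k ξ l) ^ (1 - δ) *
          ENNReal.ofReal (japInv l ^ (-α) * |l|⁻¹ * echoKernel t k ξ l) ^ δ) := by
        refine lintegral_mono_ae ?_
        filter_upwards [hne] with l hl
        have hj := japInv_pos l
        have hw := Real.rpow_nonneg hj.le (-(2 * ε))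
        have hm : 0 ≤ |l|⁻¹ * echoKernel t k ξ l :=
          mul_nonneg (by positivity) (echoKernel_nonneg t k ξ l)
        have hsplit : (japInv l ^ (-(1 + κ)) * |l|⁻¹ * echoKernel t k ξ l) ^ (1 - δ) *
            (japInv l ^ (-α) * |l|⁻¹ * echoKernel t k ξ l) ^ δ =
            japInv l ^ (-(2 * ε)) * (|l|⁻¹ * echoKernel t k ξ l) := by
          rw [mul_assoc, mul_assoc, Real.mul_rpow (Real.rpow_nonneg hj.le _) hm,
            Real.mul_rpow (Real.rpow_nonneg hj.le _) hm, ← Real.rpow_mul hj.le,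
            ← Real.rpow_mul hj.le, hexp, Real.rpow_add hj]
          have : (|l|⁻¹ * echoKernel t k ξ l) ^ (1 - δ) * (|l|⁻¹ * echoKernel t k ξ l) ^ δ =
              |l|⁻¹ * echoKernel t k ξ l := by
            rw [← Real.rpow_add' hm (by norm_num), sub_add_cancel, Real.rpow_one]
          linear_combination (japInv l ^ (-(1 + κ) * (1 - δ)) * japInv l ^ (-α * δ)) * this
        rw [ENNReal.ofReal_rpow_of_nonneg (echoIntegrand_nonneg _ t k ξ l) hδ'.le,
          ENNReal.ofReal_rpow_of_nonneg (echoIntegrand_nonneg _ t k ξ l) hδ0.le,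
          ← ENNReal.ofReal_mul (Real.rpow_nonneg (echoIntegrand_nonneg _ t k ξ l) _), hsplit,
          ← ENNReal.ofReal_mul (by positivity), mul_left_comm, ENNReal.ofReal_mul hw]
        simp_rw [div_eq_mul_one_div (japInv l ^ (-(2 * ε))), ENNReal.ofReal_mul hw]
        rw [lintegral_const_mul' _ _ ENNReal.ofReal_ne_top]
        gcongr
        exact lintegral_biotSavart_conv_le t k ξ hl
    _ ≤ ENNReal.ofReal (3 * π) *
        (ENNReal.ofReal (Upsilon κ t k ξ) ^ (1 - δ) * ENNReal.ofReal K ^ δ) := by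
        rw [lintegral_const_mul' _ _ ENNReal.ofReal_ne_top]
        gcongr
        refine (ENNReal.lintegral_mul_norm_pow_le
          (measurable_echoIntegrand _ t k ξ).ennreal_ofReal.aemeasurable
          (measurable_echoIntegrand _ t k ξ).ennreal_ofReal.aemeasurable
          hδ'.le hδ0.le (by ring)).trans ?_
        rw [hUl]
        gcongr
    _ = ENNReal.ofReal (3 * π * K ^ δ * Upsilon κ t k ξ ^ (1 - δ)) := by
        rw [ENNReal.ofReal_rpow_of_nonneg hU0 hδ'.le, ENNReal.ofReal_rpow_of_nonneg hK0 hδ0.le,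
          ← ENNReal.ofReal_mul (by positivity), ← ENNReal.ofReal_mul (by positivity)]
        congr 1
        ring
    _ ≤ _ := by
        apply ENNReal.ofReal_le_ofReal
        have := Real.rpow_nonneg hU0 (1 - δ)
        linarith
end
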